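/- Let c₁, c₂, c₃ > 0 be edge weights on the path P₄ satisfying 3/c₁ + 4/c₂ + 3/c₃ = 10. Then the algebraic connectivity satisfies λ₂(c₁,c₂,c₃) ≤ 2 − (4√3)/5. -/

import Mathlib

open Matrix

/-- The Laplacian of the weighted path `P₄` with edge weights `c₁, c₂, c₃`. -/
noncomputable def lapP4 (c₁ c₂ c₃ : ℝ) : Matrix (Fin 4) (Fin 4) ℝ :=
  !![c₁, -c₁, 0, 0; -c₁, c₁ + c₂, -c₂, 0; 0, -c₂, c₂ + c₃, -c₃; 0, 0, -c₃, c₃]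

/-- The algebraic connectivity `λ₂` of the weighted path `P₄`: the minimum (here: infimum,
which is attained) of the Rayleigh quotient `⟨Lx, x⟩ / ⟨x, x⟩` over nonzero `x ∈ ℝ⁴` with
`x₁ + x₂ + x₃ + x₄ = 0`; equivalently, the second smallest eigenvalue of the Laplacian. -/
noncomputable def lambda2P4 (c₁ c₂ c₃ : ℝ) : ℝ :=
  sInf {R : ℝ | ∃ x : Fin 4 → ℝ, x ≠ 0 ∧ x 0 + x 1 + x 2 + x 3 = 0 ∧
    R = ((lapP4 c₁ c₂ c₃).mulVec x ⬝ᵥ x) / (x ⬝ᵥ x)}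

/-- The quadratic form of the Laplacian as a weighted sum of squared differences. -/
theorem lapP4_mulVec_dotProduct (c₁ c₂ c₃ : ℝ) (x : Fin 4 → ℝ) :
    (lapP4 c₁ c₂ c₃).mulVec x ⬝ᵥ x =
      c₁ * (x 0 - x 1) ^ 2 + c₂ * (x 1 - x 2) ^ 2 + c₃ * (x 2 - x 3) ^ 2 := by
  simp [lapP4, Matrix.mulVec, dotProduct, Fin.sum_univ_four]
  ring

/-- Every admissible Rayleigh quotient bounds `lambda2P4` from above. -/
theorem lambda2P4_le_rayleigh {c₁ c₂ c₃ : ℝ} (hc₁ : 0 ≤ c₁) (hc₂ : 0 ≤ c₂) (hc₃ : 0 ≤ c₃)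
    {x : Fin 4 → ℝ} (hx : x ≠ 0) (hsum : x 0 + x 1 + x 2 + x 3 = 0) :
    lambda2P4 c₁ c₂ c₃ ≤ ((lapP4 c₁ c₂ c₃).mulVec x ⬝ᵥ x) / (x ⬝ᵥ x) := by
  refine csInf_le ⟨0, ?_⟩ ⟨x, hx, hsum, rfl⟩
  rintro _ ⟨y, -, -, rfl⟩
  rw [lapP4_mulVec_dotProduct]
  refine div_nonneg (by positivity) ?_
  exact Finset.sum_nonneg fun i _ => mul_self_nonneg (y i)

/-- **Upper bound for the algebraic connectivity of `P₄` at fixed total effective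
resistance.**  If `c₁, c₂, c₃ > 0` are edge weights on the path `P₄` with total effective
resistance `3/c₁ + 4/c₂ + 3/c₃ = 10`, then `λ₂(c₁, c₂, c₃) ≤ 2 - 4√3/5`. -/
theorem lambda2P4_le_of_resistance_eq_ten
    (c₁ c₂ c₃ : ℝ) (hc₁ : 0 < c₁) (hc₂ : 0 < c₂) (hc₃ : 0 < c₃)
    (hres : 3 / c₁ + 4 / c₂ + 3 / c₃ = 10) :
    lambda2P4 c₁ c₂ c₃ ≤ 2 - 4 * Real.sqrt 3 / 5 := by
  set s := Real.sqrt 3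
  have hs : s ^ 2 = 3 := Real.sq_sqrt (by norm_num)
  have hs2 : s < 2 := by nlinarith [Real.sqrt_nonneg 3]
  -- `p, q, r` are the potential drops driven by the flow `(√3, 2, √3)`
  obtain ⟨p, hp⟩ : ∃ p, p = s / c₁ := ⟨_, rfl⟩
  obtain ⟨q, hq⟩ : ∃ q, q = 2 / c₂ := ⟨_, rfl⟩
  obtain ⟨r, hr⟩ : ∃ r, r = s / c₃ := ⟨_, rfl⟩
  have hp' : c₁ * p = s := by rw [hp]; field_simp
  have hq' : c₂ * q = 2 := by rw [hq]; field_simp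
  have hr' : c₃ * r = s := by rw [hr]; field_simp
  have henergy : s * p + 2 * q + s * r = 10 := by
    rw [hp, hq, hr, ← hres, ← hs]
    ring
  let x : Fin 4 → ℝ := ![(3 * p + 2 * q + r) / 4, (-p + 2 * q + r) / 4,
    (-p - 2 * q + r) / 4, (-p - 2 * q - 3 * r) / 4]
  have hform : (lapP4 c₁ c₂ c₃).mulVec x ⬝ᵥ x = 10 := by
    rw [lapP4_mulVec_dotProduct]
    simp only [x, Matrix.cons_val]
    linear_combination henergy + p * hp' + q * hq' + r * hr'
  have hx : x ≠ 0 := by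
    intro h
    simp [h] at hform
  have hpos : 0 < x ⬝ᵥ x :=
    (Finset.sum_nonneg fun i _ => mul_self_nonneg (x i)).lt_of_ne'
      (mt dotProduct_self_eq_zero.mp hx)
  refine (lambda2P4_le_rayleigh hc₁.le hc₂.le hc₃.le hx
    (by simp only [x, Matrix.cons_val]; ring)).trans ?_
  rw [hform, div_le_iff₀ hpos]
  -- Cauchy–Schwarz against the divergence `(√3, 2 - √3, √3 - 2, -√3)` of the flow
  obtain ⟨k, hk⟩ : ∃ k, k = 2 - 4 * s / 5 := ⟨_, rfl⟩
  have hk0 : 0 < k := by linarith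
  have hsq : k * (k * (x ⬝ᵥ x) - 10) = (k * x 0 - s) ^ 2 + (k * x 1 - (2 - s)) ^ 2 +
      (k * x 2 - (s - 2)) ^ 2 + (k * x 3 + s) ^ 2 := by
    simp only [dotProduct, Fin.sum_univ_four, x, Matrix.cons_val]
    linear_combination 2 * k * henergy - 4 * hs + 10 * hk
  rw [← hk]
  have : 0 ≤ k * (x ⬝ᵥ x) - 10 := by
    refine nonneg_of_mul_nonneg_right ?_ hk0
    rw [hsq]
    positivity
  linarith
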